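/- Bell-basis dephasing of Bob's qubits is undetectable when Bob measures the commuting separable observables σz⊗σz and σx⊗σx: let ρ = |Ψ⁻⟩⟨Ψ⁻| ⊗ |Ψ⁻⟩⟨Ψ⁻| (16×16 matrix, ordering A,B₁,B₂,C) and τ = Σ_{b=1}^{4} (I₂⊗P_b⊗I₂) ρ (I₂⊗P_b⊗I₂). Let Q⁰_± = ½(I₄ ± σz⊗σz) and Q¹_± = ½(I₄ ± σx⊗σx) be the eigenprojectors of Bob's two observables. Then for all a,c∈{0,1}, x,z∈{0,1}, y∈{0,1} and s∈{+,−}: Tr[ρ·(Πˣ_a ⊗ Qʸ_s ⊗ Πᶻ_c)] = Tr[τ·(Πˣ_a ⊗ Qʸ_s ⊗ Πᶻ_c)]. -/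

import Mathlib

open Matrix Kronecker

noncomputable section

abbrev M2 := Matrix (Fin 2) (Fin 2) ℂ
abbrev M4 := Matrix (Fin 2 × Fin 2) (Fin 2 × Fin 2) ℂ
abbrev Quad := Fin 2 × Fin 2 × Fin 2 × Fin 2
abbrev M16 := Matrix Quad Quad ℂ

/-- Pauli Z matrix. -/
def σz : M2 := !![1, 0; 0, -1]
/-- Pauli X matrix. -/
def σx : M2 := !![0, 1; 1, 0]

/-- The complex number 1/√2. -/
def invSqrt2 : ℂ := ((Real.sqrt 2 : ℝ) : ℂ)⁻¹

/-- Bell state Φ⁺ = (|00⟩+|11⟩)/√2. -/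
def PhiP : Fin 2 × Fin 2 → ℂ := fun p =>
  if p = (0, 0) then invSqrt2 else if p = (1, 1) then invSqrt2 else 0
/-- Bell state Φ⁻ = (|00⟩−|11⟩)/√2. -/
def PhiM : Fin 2 × Fin 2 → ℂ := fun p =>
  if p = (0, 0) then invSqrt2 else if p = (1, 1) then -invSqrt2 else 0
/-- Bell state Ψ⁺ = (|01⟩+|10⟩)/√2. -/
def PsiP : Fin 2 × Fin 2 → ℂ := fun p =>
  if p = (0, 1) then invSqrt2 else if p = (1, 0) then invSqrt2 else 0
/-- Bell state Ψ⁻ = (|01⟩−|10⟩)/√2. -/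
def PsiM : Fin 2 × Fin 2 → ℂ := fun p =>
  if p = (0, 1) then invSqrt2 else if p = (1, 0) then -invSqrt2 else 0

/-- Rank-one projector |ψ⟩⟨ψ|. -/
def proj {n : Type*} (ψ : n → ℂ) : Matrix n n ℂ := vecMulVec ψ (star ψ)

/-- The four Bell states, ordered Φ⁺, Φ⁻, Ψ⁺, Ψ⁻. -/
def Bell : Fin 4 → (Fin 2 × Fin 2 → ℂ) := ![PhiP, PhiM, PsiP, PsiM]

/-- Projectors onto the Bell states. -/
def P (b : Fin 4) : M4 := proj (Bell b)

/-- Kronecker product M_A ⊗ M_{B₁B₂} ⊗ M_C, in the tensor ordering A, B₁, B₂, C. -/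
def kron3 (MA : M2) (MB : M4) (MC : M2) : M16 := fun p q =>
  MA p.1 q.1 * MB (p.2.1, p.2.2.1) (q.2.1, q.2.2.1) * MC p.2.2.2 q.2.2.2

/-- The two-singlet state vector |Ψ⁻⟩_{AB₁} ⊗ |Ψ⁻⟩_{B₂C}. -/
def twoSinglets : Quad → ℂ := fun p => PsiM (p.1, p.2.1) * PsiM (p.2.2.1, p.2.2.2)

/-- The density matrix ρ = |Ψ⁻⟩⟨Ψ⁻| ⊗ |Ψ⁻⟩⟨Ψ⁻| on A, B₁, B₂, C. -/
def ρ₂ : M16 := proj twoSinglets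

/-- Spectral projectors Πˣ_a = ½(I₂ + (−1)^a (σz + (−1)^x σx)/√2) of the
observables (σz ± σx)/√2. -/
def Proj (x a : Fin 2) : M2 :=
  (1 / 2 : ℂ) • ((1 : M2) + (((-1 : ℂ) ^ (a : ℕ)) * invSqrt2) • (σz + ((-1 : ℂ) ^ (x : ℕ)) • σx))

/-- Eigenprojectors Qʸ_s = ½(I₄ + (−1)^s σ⊗σ) of σz⊗σz (y = 0) and σx⊗σx (y = 1);
s = 0 is the "+" projector and s = 1 the "−" projector. -/
def Q (y s : Fin 2) : M4 :=
  (1 / 2 : ℂ) • ((1 : M4) + ((-1 : ℂ) ^ (s : ℕ)) • (if y = 0 then σz ⊗ₖ σz else σx ⊗ₖ σx))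

/-- Correlator ⟨ψ|(A ⊗ C)|ψ⟩ of two single-qubit observables on a two-qubit state. -/
def corr (ψ : Fin 2 × Fin 2 → ℂ) (A C : M2) : ℂ := star ψ ⬝ᵥ ((A ⊗ₖ C) *ᵥ ψ)
/-- The state obtained from ρ by dephasing Bob's two qubits in the Bell basis. -/
def τ₂ : M16 := ∑ b : Fin 4, kron3 1 (P b) 1 * ρ₂ * kron3 1 (P b) 1

theorem hs_star : (starRingEnd ℂ) invSqrt2 = invSqrt2 := by
  simp [invSqrt2]

theorem hs_sq : invSqrt2 ^ 2 = 1 / 2 := by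
  unfold invSqrt2
  rw [inv_pow, ← Complex.ofReal_pow, Real.sq_sqrt (by norm_num)]
  norm_num

theorem kron3_mul (A A' : M2) (B B' : M4) (C C' : M2) :
    kron3 A B C * kron3 A' B' C' = kron3 (A * A') (B * B') (C * C') := by
  ext p q
  simp only [Matrix.mul_apply, kron3, Fintype.sum_prod_type, Fin.sum_univ_two]
  ring

theorem kron3_sum (A : M2) (B : Fin 4 → M4) (C : M2) :
    ∑ b, kron3 A (B b) C = kron3 A (∑ b, B b) C := by
  ext p q
  simp only [Matrix.sum_apply, kron3, Finset.mul_sum, Finset.sum_mul]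

theorem P_sum : ∑ b, P b = 1 := by
  have h := hs_sq
  ext ⟨i, j⟩ ⟨k, l⟩
  fin_cases i <;> fin_cases j <;> fin_cases k <;> fin_cases l <;>
    simp [Fin.sum_univ_four, P, proj, Bell, PhiP, PhiM, PsiP, PsiM, vecMulVec_apply, hs_star,
      Matrix.add_apply] <;> linear_combination 2 * h

theorem P_idem (b : Fin 4) : P b * P b = P b := by
  have h := hs_sq
  have : star (Bell b) ⬝ᵥ Bell b = 1 := by
    fin_cases b <;>
    simp [dotProduct, Fintype.sum_prod_type, Bell, PhiP, PhiM, PsiP, PsiM, hs_star] <;>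
    linear_combination 2 * h
  simp [P, proj, vecMulVec_mul_vecMulVec, this]

theorem P_comm (b : Fin 4) (y s : Fin 2) : P b * Q y s = Q y s * P b := by
  have key : P b * (if y = 0 then σz ⊗ₖ σz else σx ⊗ₖ σx) =
      (if y = 0 then σz ⊗ₖ σz else σx ⊗ₖ σx) * P b := by
    ext ⟨i, j⟩ ⟨k, l⟩
    fin_cases y <;> fin_cases b <;>
    fin_cases i <;> fin_cases j <;> fin_cases k <;> fin_cases l <;>
    simp [Matrix.mul_apply, Fintype.sum_prod_type, P, proj, Bell, PhiP, PhiM, PsiP, PsiM,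
      vecMulVec_apply, hs_star, σz, σx]
  simp only [Q, Matrix.mul_smul, Matrix.smul_mul, Matrix.mul_add, Matrix.add_mul, key,
    Matrix.mul_one, Matrix.one_mul]

theorem PQP_sum (y s : Fin 2) : ∑ b, P b * Q y s * P b = Q y s := by
  simp only [P_comm, Matrix.mul_assoc, P_idem]
  rw [← Finset.mul_sum, P_sum, Matrix.mul_one]

/-- Bell-basis dephasing of Bob's qubits is undetectable when Bob measures the
commuting separable observables σz⊗σz (y = 0) and σx⊗σx (y = 1): all joint
outcome probabilities agree on ρ and τ (s = 0 is the "+" outcome, s = 1 the "−"). -/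
theorem dephasing_undetectable_separable (a c x z y s : Fin 2) :
    trace (ρ₂ * kron3 (Proj x a) (Q y s) (Proj z c)) =
      trace (τ₂ * kron3 (Proj x a) (Q y s) (Proj z c)) := by
  have e : ∀ b, trace (kron3 1 (P b) 1 * ρ₂ * kron3 1 (P b) 1 *
      kron3 (Proj x a) (Q y s) (Proj z c)) =
      trace (ρ₂ * kron3 (Proj x a) (P b * Q y s * P b) (Proj z c)) := by
    intro b
    rw [Matrix.mul_assoc, Matrix.mul_assoc, Matrix.trace_mul_comm, Matrix.mul_assoc,
      kron3_mul, kron3_mul]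
    simp only [Matrix.one_mul, Matrix.mul_one]
  rw [τ₂, Finset.sum_mul, Matrix.trace_sum]
  simp only [e]
  rw [← Matrix.trace_sum, ← Finset.mul_sum, kron3_sum, PQP_sum]
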